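/- arXiv:0801.3260 — 3 statements merged into one kernel-verified Lean document; each statement's English description precedes it below -/
import Mathlib

section
/- Let (V, Y, c) be a vertex coalgebra over F and let D* = (Id_V ⊗ c)Δ_{-2}. Then (Id_V ⊗ c)Y(x) = e^{x D*}; equivalently, for every n ≥ 0 and v ∈ V, (Id_V ⊗ c)(Δ_{−n−1}(v)) = (D*)^n v / n!, and (Id_V ⊗ c)(Δ_k(v)) = 0 for all k ≥ 0. -/
/- Common background for the formalization of "Vertex coalgebras, comodules,
cocommutativity and coassociativity" (K. Hubbard).

A vertex coalgebra `(V, Y, c)` is encoded by the family of coefficient maps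
`Δ k : V →ₗ V ⊗ V` of the coproduct `Y(x)v = ∑ₖ Δ k v · x^(-k-1)` together with
the covacuum `c : V →ₗ F`.  All identities of formal series are encoded
coefficient-wise; in particular the Jacobi identity is encoded by its
(dual Borcherds) coefficient form. -/

noncomputable section

open scoped TensorProduct

variable (F : Type) [Field F] [CharZero F]

/-- The generalized binomial coefficient `(a choose i)` as an element of `F`. -/
def gchoose (a : ℤ) (i : ℕ) : F :=
  (∏ j ∈ Finset.range i, ((a : F) - (j : F))) / (Nat.factorial i : F)

variable {V M : Type} [AddCommGroup V] [Module F V] [AddCommGroup M] [Module F M]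

/-- `c ⊗ Id` composed with the canonical identification `F ⊗ M ≃ M`. -/
def cLeft (c : V →ₗ[F] F) : V ⊗[F] M →ₗ[F] M :=
  (TensorProduct.lid F M).toLinearMap ∘ₗ TensorProduct.map c LinearMap.id

/-- `Id ⊗ c` composed with the canonical identification `V ⊗ F ≃ V`. -/
def cRight (c : M →ₗ[F] F) : V ⊗[F] M →ₗ[F] V :=
  (TensorProduct.rid F V).toLinearMap ∘ₗ TensorProduct.map LinearMap.id c

/-- The transposition `T ⊗ Id` of the first two tensor factors of `V ⊗ (V ⊗ M)`. -/
def Tfirst : V ⊗[F] (V ⊗[F] M) →ₗ[F] V ⊗[F] (V ⊗[F] M) :=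
  (TensorProduct.assoc F V V M).toLinearMap ∘ₗ
    TensorProduct.map (TensorProduct.comm F V V).toLinearMap LinearMap.id ∘ₗ
    (TensorProduct.assoc F V V M).symm.toLinearMap

/-- The coefficient of `x₁^(-m-1) x₂^(-n-1)` in `(Id ⊗ Y(x₂)) Y(x₁)`. -/
def comp12 (ΔM : ℤ → M →ₗ[F] V ⊗[F] M) (m n : ℤ) : M →ₗ[F] V ⊗[F] (V ⊗[F] M) :=
  TensorProduct.map LinearMap.id (ΔM n) ∘ₗ ΔM m

/-- The coefficient of `x₀^(-m-1) x₂^(-n-1)` in `(Y(x₀) ⊗ Id) Y(x₂)`. -/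
def compR (ΔV : ℤ → V →ₗ[F] V ⊗[F] V) (ΔM : ℤ → M →ₗ[F] V ⊗[F] M) (m n : ℤ) :
    M →ₗ[F] V ⊗[F] (V ⊗[F] M) :=
  (TensorProduct.assoc F V V M).toLinearMap ∘ₗ TensorProduct.map (ΔV m) LinearMap.id ∘ₗ ΔM n

/-- The coefficient form of the (comodule) Jacobi identity of a vertex coalgebra,
obtained by extracting the coefficient of `x₀^(-a-1) x₁^(-b-1) x₂^(-c-1)`. -/
def JacobiId (ΔV : ℤ → V →ₗ[F] V ⊗[F] V) (ΔM : ℤ → M →ₗ[F] V ⊗[F] M) : Prop :=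
  ∀ (a b c : ℤ) (w : M),
    (∑ᶠ i : ℕ, ((-1 : F) ^ i * gchoose F a i) •
        (comp12 F ΔM (a + b - i) (c + i) w -
          (-1 : F) ^ a • Tfirst F (comp12 F ΔM (a + c - i) (b + i) w))) =
      ∑ᶠ i : ℕ, gchoose F b i • compR F ΔV ΔM (a + i) (b + c - i) w

/-- The axioms of a vertex coalgebra except the Jacobi identity: left counit,
cocreation and truncation, in coefficient form. -/
def IsVertexCoalgSansJacobi (Δ : ℤ → V →ₗ[F] V ⊗[F] V) (c : V →ₗ[F] F) : Prop :=
  (∀ v : V, cLeft F c (Δ (-1) v) = v) ∧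
  (∀ k : ℤ, k ≠ -1 → ∀ v : V, cLeft F c (Δ k v) = 0) ∧
  (∀ v : V, cRight F c (Δ (-1) v) = v) ∧
  (∀ k : ℤ, 0 ≤ k → ∀ v : V, cRight F c (Δ k v) = 0) ∧
  (∀ v : V, ∃ N : ℤ, ∀ k : ℤ, k < N → Δ k v = 0)

/-- The axioms of a vertex coalgebra. -/
def IsVertexCoalg (Δ : ℤ → V →ₗ[F] V ⊗[F] V) (c : V →ₗ[F] F) : Prop :=
  IsVertexCoalgSansJacobi F Δ c ∧ JacobiId F Δ Δ

/-- The weight-`m` component of `V ⊗ V` for a graded space `V`. -/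
def grT2 (gr : ℤ → Submodule F V) (m : ℤ) : Submodule F (V ⊗[F] V) :=
  ⨆ p : ℤ, LinearMap.range (TensorProduct.map (gr p).subtype (gr (m - p)).subtype)

/-- The weight-`m` component of `V ⊗ (V ⊗ V)` for a graded space `V`. -/
def grT3 (gr : ℤ → Submodule F V) (m : ℤ) : Submodule F (V ⊗[F] (V ⊗[F] V)) :=
  ⨆ p : ℤ × ℤ, LinearMap.range (TensorProduct.map (gr p.1).subtype
    (TensorProduct.map (gr p.2).subtype (gr (m - p.1 - p.2)).subtype))

/-- The grading axioms of a graded vertex coalgebra: `V = ⊕ₖ V₍ₖ₎` internally,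
`V₍ₖ₎ = 0` for `k` sufficiently small, and `Δ k` raises weight by `k + 1`. -/
def IsGradedVC (Δ : ℤ → V →ₗ[F] V ⊗[F] V) (gr : ℤ → Submodule F V) : Prop :=
  DirectSum.IsInternal gr ∧ (∃ N : ℤ, ∀ k : ℤ, k < N → gr k = ⊥) ∧
  (∀ r k : ℤ, ∀ v ∈ gr r, Δ k v ∈ grT2 F gr (r + k + 1))

/-- `f` belongs to the graded dual `(V^{⊗3})'`: it vanishes on all but finitely
many homogeneous components of `V ⊗ V ⊗ V`. -/
def GradedDual3 (gr : ℤ → Submodule F V) (f : V ⊗[F] (V ⊗[F] V) →ₗ[F] F) : Prop :=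
  ∃ s : Finset ℤ, ∀ m : ℤ, m ∉ s → ∀ u ∈ grT3 F gr m, f u = 0

/-- The weight-`q` component of `V ⊗ M` for `V` a `ℤ`-graded space and
`M` a `ℚ`-graded space. -/
def grVM (gr : ℤ → Submodule F V) (grM : ℚ → Submodule F M) (q : ℚ) :
    Submodule F (V ⊗[F] M) :=
  ⨆ p : ℤ, LinearMap.range (TensorProduct.map (gr p).subtype (grM (q - p)).subtype)

/-- The weight-`q` component of `V ⊗ (V ⊗ M)`. -/
def grVVM (gr : ℤ → Submodule F V) (grM : ℚ → Submodule F M) (q : ℚ) :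
    Submodule F (V ⊗[F] (V ⊗[F] M)) :=
  ⨆ p : ℤ × ℤ, LinearMap.range (TensorProduct.map (gr p.1).subtype
    (TensorProduct.map (gr p.2).subtype (grM (q - p.1 - p.2)).subtype))

/-- `f` belongs to the graded dual `(V ⊗ V ⊗ M)'`. -/
def GradedDualVVM (gr : ℤ → Submodule F V) (grM : ℚ → Submodule F M)
    (f : V ⊗[F] (V ⊗[F] M) →ₗ[F] F) : Prop :=
  ∃ s : Finset ℚ, ∀ q : ℚ, q ∉ s → ∀ u ∈ grVVM F gr grM q, f u = 0

/-- The axioms of a comodule over a graded vertex coalgebra, except the Jacobi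
identity: left counit, truncation, internal `ℚ`-grading bounded below, and the
grading condition on the comodule coproduct. -/
def IsComoduleSansJacobi (c : V →ₗ[F] F) (ΔM : ℤ → M →ₗ[F] V ⊗[F] M)
    (gr : ℤ → Submodule F V) (grM : ℚ → Submodule F M) : Prop :=
  (∀ w : M, cLeft F c (ΔM (-1) w) = w) ∧
  (∀ k : ℤ, k ≠ -1 → ∀ w : M, cLeft F c (ΔM k w) = 0) ∧
  (∀ w : M, ∃ N : ℤ, ∀ k : ℤ, k < N → ΔM k w = 0) ∧
  DirectSum.IsInternal grM ∧ (∃ N : ℚ, ∀ q : ℚ, q < N → grM q = ⊥) ∧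
  (∀ (j : ℚ) (k : ℤ), ∀ w ∈ grM j, ΔM k w ∈ grVM F gr grM (j + k + 1))

/-- Weak cocommutativity with exponent `k`, paired against `f`, coefficient-wise:
the coefficient of `x₁^(-b-1) x₂^(-c-1)` in
`(x₁-x₂)^k ⟨f, (Id ⊗ Y(x₂))Y(x₁)w - (T ⊗ Id)(Id ⊗ Y(x₁))Y(x₂)w⟩` vanishes. -/
def WeakCocom (ΔM : ℤ → M →ₗ[F] V ⊗[F] M) (f : V ⊗[F] (V ⊗[F] M) →ₗ[F] F)
    (k : ℕ) : Prop :=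
  ∀ (w : M) (b c : ℤ),
    ∑ j ∈ Finset.range (k + 1), ((-1 : F) ^ j * (k.choose j : F)) *
      (f (comp12 F ΔM (b + k - j) (c + j) w) -
        f (Tfirst F (comp12 F ΔM (c + j) (b + k - j) w))) = 0

/-- Weak coassociativity with exponent `k`, paired against `f`, coefficient-wise:
the coefficient of `x₀^(-a-1) x₂^(-c-1)` in
`(x₀+x₂)^k ⟨f, (Y(x₀) ⊗ Id)Y(x₂)w - (Id ⊗ Y(x₂))Y(x₀+x₂)w⟩` vanishes,
`Y(x₀+x₂)` being expanded in nonnegative integral powers of `x₂`. -/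
def WeakCoassoc (ΔV : ℤ → V →ₗ[F] V ⊗[F] V) (ΔM : ℤ → M →ₗ[F] V ⊗[F] M)
    (f : V ⊗[F] (V ⊗[F] M) →ₗ[F] F) (k : ℕ) : Prop :=
  ∀ (w : M) (a c : ℤ),
    ∑ j ∈ Finset.range (k + 1), (k.choose j : F) *
      (f (compR F ΔV ΔM (a + k - j) (c + j) w) -
        ∑ᶠ i : ℕ, ((-1 : F) ^ i * gchoose F (a + k - j) i) *
          f (comp12 F ΔM (a + k - j - i) (c + j + i) w)) = 0

/-- The coefficient function of `x^r y^s (x + ε y)^t · A`, where `A : ℤ → ℤ → F`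
is the coefficient function of a formal series (`A m n` is the coefficient of
`x^m y^n`). -/
def mulPoly (r s t : ℕ) (ε : F) (A : ℤ → ℤ → F) (m n : ℤ) : F :=
  ∑ j ∈ Finset.range (t + 1), (t.choose j : F) * ε ^ j *
    A (m - (r : ℤ) - ((t - j : ℕ) : ℤ)) (n - (s : ℤ) - (j : ℤ))

/-- `g` is the coefficient function of a polynomial in two variables. -/
def IsPolyCoeff (g : ℤ → ℤ → F) : Prop :=
  {p : ℤ × ℤ | g p.1 p.2 ≠ 0}.Finite ∧ ∀ m n : ℤ, m < 0 ∨ n < 0 → g m n = 0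

/-- The coefficient function of the polynomial `h(x₁ - x₂, x₂)` in the
variables `x₁, x₂`, given the coefficient function of `h = h(x₀, x₂)`. -/
def substC (h : ℤ → ℤ → F) (m n : ℤ) : F :=
  ∑ᶠ j : ℕ, ((-1 : F) ^ j * gchoose F (m + j) j) * h (m + j) (n - j)

/-- The coefficient form of the Jacobi identity of a vertex algebra (the
Borcherds identity). -/
def VAJacobi (mul : ℤ → V →ₗ[F] V →ₗ[F] V) : Prop :=
  ∀ (a b c : ℤ) (u v w : V),
    (∑ᶠ i : ℕ, ((-1 : F) ^ i * gchoose F a i) •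
        (mul (a + b - i) u (mul (c + i) v w) -
          (-1 : F) ^ a • mul (a + c - i) v (mul (b + i) u w))) =
      ∑ᶠ i : ℕ, gchoose F b i • mul (b + c - i) (mul (a + i) u v) w

/-- The axioms of a vertex algebra: truncation, vacuum, creation and the Jacobi
identity, in coefficient form (`mul n u v` is `u_n v`). -/
def IsVA (mul : ℤ → V →ₗ[F] V →ₗ[F] V) (one : V) : Prop :=
  (∀ u v : V, ∃ N : ℤ, ∀ n : ℤ, N < n → mul n u v = 0) ∧
  (∀ v : V, mul (-1) one v = v) ∧
  (∀ n : ℤ, n ≠ -1 → ∀ v : V, mul n one v = 0) ∧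
  (∀ v : V, mul (-1) v one = v) ∧
  (∀ n : ℤ, 0 ≤ n → ∀ v : V, mul n v one = 0) ∧
  VAJacobi F mul

/-- The graded dual `V' = ⊕ₖ V₍ₖ₎*`, realized as the submodule of the full dual
consisting of functionals vanishing on all but finitely many components. -/
def gradedDual (gr : ℤ → Submodule F V) : Submodule F (Module.Dual F V) where
  carrier := {φ | ∃ s : Finset ℤ, ∀ k ∉ s, ∀ u ∈ gr k, φ u = 0}
  zero_mem' := ⟨∅, by intro k _ u _; simp⟩
  add_mem' := by
    rintro a b ⟨s, hs⟩ ⟨t, ht⟩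
    refine ⟨s ∪ t, ?_⟩
    intro k hk u hu
    simp only [Finset.mem_union, not_or] at hk
    simp [LinearMap.add_apply, hs k hk.1 u hu, ht k hk.2 u hu]
  smul_mem' := by
    rintro r a ⟨s, hs⟩
    refine ⟨s, ?_⟩
    intro k hk u hu
    simp [LinearMap.smul_apply, hs k hk u hu]

/-- The weight-`k` component `V₍ₖ₎* ⊆ V'` of the graded dual: functionals
vanishing on every component of weight other than `k`. -/
def gradedDualPiece (gr : ℤ → Submodule F V) (k : ℤ) :
    Submodule F ↥(gradedDual F gr) where
  carrier := {φ | ∀ j : ℤ, j ≠ k → ∀ u ∈ gr j, (φ : Module.Dual F V) u = 0}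
  zero_mem' := by intro j _ u _; simp
  add_mem' := by
    intro a b ha hb j hj u hu
    simp [ha j hj u hu, hb j hj u hu]
  smul_mem' := by
    intro r a ha j hj u hu
    simp [ha j hj u hu]

/-- The natural pairing of `V' ⊗ V'` with `V ⊗ V`. -/
def pairVV (gr : ℤ → Submodule F V) :
    ↥(gradedDual F gr) ⊗[F] ↥(gradedDual F gr) →ₗ[F] Module.Dual F (V ⊗[F] V) :=
  TensorProduct.dualDistrib F V V ∘ₗ
    TensorProduct.map (gradedDual F gr).subtype (gradedDual F gr).subtype

/-- The covacuum map on the graded dual: evaluation at the vacuum. -/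
def covac (gr : ℤ → Submodule F V) (one : V) : ↥(gradedDual F gr) →ₗ[F] F :=
  LinearMap.applyₗ one ∘ₗ (gradedDual F gr).subtype

/-- A bilinear form `B` on `V` extended componentwise to `V ⊗ V`. -/
def formT2 (B : V →ₗ[F] V →ₗ[F] F) : V ⊗[F] V →ₗ[F] Module.Dual F (V ⊗[F] V) :=
  TensorProduct.dualDistrib F V V ∘ₗ TensorProduct.map B B

section CocreationExponential

set_option linter.unusedSectionVars false

theorem cLeft_map {N : Type} [AddCommGroup N] [Module F N] (c : V →ₗ[F] F) (g : M →ₗ[F] N)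
    (t : V ⊗[F] M) : cLeft F c (TensorProduct.map LinearMap.id g t) = g (cLeft F c t) := by
  induction t with
  | zero => simp
  | add x y hx hy => simp [hx, hy]
  | tmul x y => simp [cLeft]

theorem cRight_map {N : Type} [AddCommGroup N] [Module F N] (c : M →ₗ[F] F) (g : V →ₗ[F] N)
    (t : V ⊗[F] M) : cRight F c (TensorProduct.map g LinearMap.id t) = g (cRight F c t) := by
  induction t with
  | zero => simp
  | add x y hx hy => simp [hx, hy]
  | tmul x y => simp [cRight]

/-- Applying `c` to the last two factors of `V ⊗ (V ⊗ V)`. -/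
def cRightTwo (c : V →ₗ[F] F) : V ⊗[F] (V ⊗[F] V) →ₗ[F] V :=
  cRight F c ∘ₗ TensorProduct.map LinearMap.id (cLeft F c)

theorem cRightTwo_comp12 (Δ : ℤ → V →ₗ[F] V ⊗[F] V) (c : V →ₗ[F] F) (m n : ℤ) (v : V) :
    cRightTwo F c (comp12 F Δ m n v) =
      cRight F c (TensorProduct.map LinearMap.id (cLeft F c ∘ₗ Δ n) (Δ m v)) := by
  simp only [cRightTwo, comp12, LinearMap.comp_apply]
  rw [← LinearMap.comp_apply (TensorProduct.map _ _), ← TensorProduct.map_comp,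
    LinearMap.id_comp]

theorem cRightTwo_Tfirst (c : V →ₗ[F] F) (t : V ⊗[F] (V ⊗[F] V)) :
    cRightTwo F c (Tfirst F t) = cRight F c (cLeft F c t) := by
  induction t with
  | zero => simp
  | add x y hx hy => simp [hx, hy]
  | tmul x s =>
    induction s with
    | zero => simp
    | add y z hy hz => simp [TensorProduct.tmul_add, hy, hz]
    | tmul y z => simp [cRightTwo, Tfirst, cRight, cLeft, smul_smul]

theorem cRightTwo_assoc (c : V →ₗ[F] F) (t : (V ⊗[F] V) ⊗[F] V) :
    cRightTwo F c (TensorProduct.assoc F V V V t) = cRight F c (cRight F c t) := by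
  induction t with
  | zero => simp
  | add x y hx hy => simp [hx, hy]
  | tmul s z =>
    induction s with
    | zero => simp
    | add x y hx hy => simp [TensorProduct.add_tmul, hx, hy]
    | tmul x y => simp [cRightTwo, cRight, cLeft, smul_smul, mul_comm]

theorem cRightTwo_compR (Δ : ℤ → V →ₗ[F] V ⊗[F] V) (c : V →ₗ[F] F) (m n : ℤ) (v : V) :
    cRightTwo F c (compR F Δ Δ m n v) = cRight F c (Δ m (cRight F c (Δ n v))) := by
  simp only [compR, LinearMap.comp_apply, LinearEquiv.coe_coe]
  rw [cRightTwo_assoc, cRight_map]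

theorem gchoose_neg_two (n : ℕ) : gchoose F (-2) n = (-1) ^ n * ((n : F) + 1) := by
  have h : ∏ j ∈ Finset.range n, (((-2 : ℤ) : F) - (j : F)) =
      (-1) ^ n * (Nat.factorial (n + 1) : F) := by
    induction n with
    | zero => simp
    | succ n ih =>
      rw [Finset.prod_range_succ, ih, Nat.factorial_succ (n + 1)]
      push_cast
      ring
  have h0 : (Nat.factorial n : F) ≠ 0 := Nat.cast_ne_zero.mpr n.factorial_ne_zero
  rw [gchoose, h, Nat.factorial_succ, div_eq_iff h0]
  push_cast
  ring

theorem gchoose_zero_left (n : ℕ) : gchoose F 0 n = if n = 0 then 1 else 0 := by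
  rcases n with _ | n
  · simp [gchoose]
  · simp [gchoose, Finset.prod_range_succ']

/-- The coefficients of `D* (Id ⊗ c)Y(x) = d/dx (Id ⊗ c)Y(x)`. -/
theorem cRight_coproduct_neg_two_comp (Δ : ℤ → V →ₗ[F] V ⊗[F] V) (c : V →ₗ[F] F)
    (hVC : IsVertexCoalg F Δ c) (n : ℕ) (v : V) :
    cRight F c (Δ (-2) (cRight F c (Δ (-(n : ℤ) - 1) v))) =
      ((n : F) + 1) • cRight F c (Δ (-(n : ℤ) - 2) v) := by
  obtain ⟨⟨hl, hl', -, hr, ht⟩, hJ⟩ := hVC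
  have hcoeff (m k : ℤ) : cRightTwo F c (comp12 F Δ m k v) =
      if k = -1 then cRight F c (Δ m v) else 0 := by
    rw [cRightTwo_comp12]
    split_ifs with hk
    · subst hk
      rw [show cLeft F c ∘ₗ Δ (-1) = LinearMap.id from LinearMap.ext hl, TensorProduct.map_id,
        LinearMap.id_apply]
    · rw [show cLeft F c ∘ₗ Δ k = 0 from LinearMap.ext (hl' k hk)]
      simp
  have hswap (m : ℤ) (i : ℕ) : cRightTwo F c (Tfirst F (comp12 F Δ m (0 + i) v)) = 0 := by
    rw [cRightTwo_Tfirst, comp12, LinearMap.comp_apply, cLeft_map]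
    exact hr _ (by omega) _
  obtain ⟨N, hN⟩ := ht v
  have hcomp (m k : ℤ) (hm : m < N) : comp12 F Δ m k v = 0 := by simp [comp12, hN m hm]
  have hJ := congrArg (cRightTwo F c) (hJ (-2) 0 (-(n : ℤ) - 1) v)
  rw [finsum_eq_single (fun i : ℕ => gchoose F 0 i • compR F Δ Δ (-2 + i) (0 + (-n - 1) - i) v) 0
    (fun i hi => by simp [gchoose_zero_left, hi]), gchoose_zero_left, if_pos rfl, one_smul,
    cRightTwo_compR, map_finsum, finsum_eq_single _ n] at hJ
  · rw [map_smul, map_sub, map_smul, hswap, hcoeff, if_pos (by ring), smul_zero, sub_zero,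
      gchoose_neg_two, ← mul_assoc, ← mul_pow] at hJ
    simp only [mul_neg, mul_one, neg_neg, one_pow, one_mul, Nat.cast_zero, add_zero, zero_add,
      sub_zero] at hJ
    rw [← hJ, neg_sub_comm]
  · intro i hi
    rw [map_smul, map_sub, map_smul, hswap, hcoeff, if_neg (by omega)]
    simp
  · refine (Set.finite_Iic (n + N.natAbs + 2)).subset fun i hi => ?_
    by_contra hlt
    rw [Set.mem_Iic, not_le] at hlt
    refine hi ?_
    beta_reduce
    rw [hcomp _ _ (by omega), hcomp _ _ (by omega)]
    simp

end CocreationExponential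

/-- For a vertex coalgebra `(V, Y, c)` with `D* = (Id ⊗ c)Δ₋₂`,
`(Id ⊗ c)Y(x) = e^{x D*}`: `(Id ⊗ c)(Δ (-n-1) v) = (D*)^n v / n!` for `n ≥ 0`,
and `(Id ⊗ c)(Δ k v) = 0` for `k ≥ 0`. -/
theorem cocreation_exponential
    (Δ : ℤ → V →ₗ[F] V ⊗[F] V) (c : V →ₗ[F] F)
    (hVC : IsVertexCoalg F Δ c)
    (Dstar : V →ₗ[F] V) (hD : Dstar = cRight F c ∘ₗ Δ (-2)) :
    (∀ (n : ℕ) (v : V),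
        cRight F c (Δ (-(n : ℤ) - 1) v) = (Nat.factorial n : F)⁻¹ • (Dstar ^ n) v) ∧
    (∀ k : ℤ, 0 ≤ k → ∀ v : V, cRight F c (Δ k v) = 0) := by
  subst hD
  refine ⟨fun n => ?_, hVC.1.2.2.2.1⟩
  induction n with
  | zero => intro v; simpa using hVC.1.2.2.1 v
  | succ n ih =>
    intro v
    have hn : (n : F) + 1 ≠ 0 := n.cast_add_one_ne_zero
    have h := cRight_coproduct_neg_two_comp F Δ c hVC n v
    rw [ih v, map_smul, map_smul] at h
    rw [show -((n + 1 : ℕ) : ℤ) - 1 = -(n : ℤ) - 2 by push_cast; ring, pow_succ',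
      Module.End.mul_apply, LinearMap.comp_apply, Nat.factorial_succ]
    push_cast
    rw [mul_inv, mul_smul, h, inv_smul_smul₀ hn]
end
end

section
/- (D*-bracket formula.) Let (V, Y, c) be a vertex coalgebra over F and let D* = (Id_V ⊗ c)Δ_{-2}. Then (d/dx)Y(x) = Y(x)∘D* − (Id_V ⊗ D*)∘Y(x); equivalently, for every k ∈ ℤ and v ∈ V, −k · Δ_{k−1}(v) = Δ_k(D* v) − (Id_V ⊗ D*)(Δ_k(v)). -/
/- Common background for the formalization of "Vertex coalgebras, comodules,
cocommutativity and coassociativity" (K. Hubbard).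

A vertex coalgebra `(V, Y, c)` is encoded by the family of coefficient maps
`Δ k : V →ₗ V ⊗ V` of the coproduct `Y(x)v = ∑ₖ Δ k v · x^(-k-1)` together with
the covacuum `c : V →ₗ F`.  All identities of formal series are encoded
coefficient-wise; in particular the Jacobi identity is encoded by its
(dual Borcherds) coefficient form. -/

noncomputable section

open scoped TensorProduct

variable (F : Type) [Field F] [CharZero F]

variable {V M : Type} [AddCommGroup V] [Module F V] [AddCommGroup M] [Module F M]

section Contraction

variable (K : Type) [Field K] {U W : Type} [AddCommGroup U] [Module K U]
  [AddCommGroup W] [Module K W]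

@[simp]
theorem gchoose_zero_right (a : ℤ) : gchoose K a 0 = 1 := by
  simp [gchoose]

@[simp]
theorem gchoose_one_right (a : ℤ) : gchoose K a 1 = a := by
  simp [gchoose]

theorem gchoose_zero_left_s3 {i : ℕ} (hi : i ≠ 0) : gchoose K 0 i = 0 := by
  obtain ⟨j, rfl⟩ := Nat.exists_eq_succ_of_ne_zero hi
  simp [gchoose, Finset.prod_range_succ']

@[simp]
theorem cRight_tmul (c : W →ₗ[K] K) (u : U) (w : W) : cRight K c (u ⊗ₜ w) = c w • u := by
  simp [cRight]

/-- Contracting the last factor of `(Id ⊗ Δₙ) Δₘ`. -/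
theorem map_cRight_comp12 (Δ : ℤ → W →ₗ[K] U ⊗[K] W) (c : W →ₗ[K] K) (m n : ℤ) (w : W) :
    TensorProduct.map LinearMap.id (cRight K c) (comp12 K Δ m n w) =
      TensorProduct.map LinearMap.id (cRight K c ∘ₗ Δ n) (Δ m w) := by
  simp [comp12, TensorProduct.map_map]

/-- Contracting the last factor commutes with transposing the first two. -/
theorem map_cRight_Tfirst (c : W →ₗ[K] K) (t : U ⊗[K] (U ⊗[K] W)) :
    TensorProduct.map LinearMap.id (cRight K c) (Tfirst K t) =
      TensorProduct.comm K U U (TensorProduct.map LinearMap.id (cRight K c) t) := by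
  induction t with
  | zero => simp
  | add x y hx hy => simp [hx, hy]
  | tmul u s =>
    induction s with
    | zero => simp
    | add x y hx hy => simp [TensorProduct.tmul_add, hx, hy]
    | tmul v w => simp [Tfirst]

/-- Contracting the last factor of `(Δₘ ⊗ Id) Δₙ`. -/
theorem map_cRight_compR (ΔV : ℤ → U →ₗ[K] U ⊗[K] U) (Δ : ℤ → W →ₗ[K] U ⊗[K] W)
    (c : W →ₗ[K] K) (m n : ℤ) (w : W) :
    TensorProduct.map LinearMap.id (cRight K c) (compR K ΔV Δ m n w) =
      ΔV m (cRight K c (Δ n w)) := by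
  have assoc_contract (t : U ⊗[K] U) (w : W) :
      TensorProduct.map LinearMap.id (cRight K c) (TensorProduct.assoc K U U W (t ⊗ₜ w)) =
        c w • t := by
    induction t with
    | zero => simp
    | add x y hx hy => simp [TensorProduct.add_tmul, hx, hy]
    | tmul u v => simp
  simp only [compR, LinearMap.comp_apply, LinearEquiv.coe_coe]
  induction Δ n w with
  | zero => simp
  | add x y hx hy => simp [hx, hy]
  | tmul u v => simp [assoc_contract]

end Contraction

/-- `D*`-bracket formula: For a vertex coalgebra `(V, Y, c)` with
`D* = (Id ⊗ c)Δ₋₂`, `(d/dx)Y(x) = Y(x)∘D* - (Id ⊗ D*)∘Y(x)`: for every `k`, `v`,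
`-k • Δ (k-1) v = Δ k (D* v) - (Id ⊗ D*)(Δ k v)`. -/
theorem Dstar_bracket
    (Δ : ℤ → V →ₗ[F] V ⊗[F] V) (c : V →ₗ[F] F)
    (hVC : IsVertexCoalg F Δ c)
    (Dstar : V →ₗ[F] V) (hD : Dstar = cRight F c ∘ₗ Δ (-2)) :
    ∀ (k : ℤ) (v : V),
      (-(k : F)) • Δ (k - 1) v =
        Δ k (Dstar v) - TensorProduct.map LinearMap.id Dstar (Δ k v) := by
  obtain ⟨⟨-, -, hcr, hcr0, htr⟩, hJ⟩ := hVC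
  intro k v
  have hid : cRight F c ∘ₗ Δ (-1) = LinearMap.id := LinearMap.ext hcr
  have hzero (n : ℤ) (hn : 0 ≤ n) : cRight F c ∘ₗ Δ n = 0 := LinearMap.ext (hcr0 n hn)
  have key := hJ k 0 (-2) v
  rw [finsum_eq_single (fun i : ℕ ↦ gchoose F 0 i • compR F Δ Δ (k + i) (0 + -2 - i) v) 0
    fun i hi ↦ by rw [gchoose_zero_left_s3 F hi, zero_smul]] at key
  obtain ⟨N, hN⟩ := htr v
  rw [finsum_eq_sum_of_support_subset (s := Finset.range ((k - N).toNat + 2)) _ (by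
    intro i hi
    by_contra hlt
    have hlt : (k - N).toNat + 2 ≤ i := by simpa using hlt
    refine hi ?_
    simp only [comp12, LinearMap.comp_apply, hN (k + 0 - i) (by omega),
      hN (k + -2 - i) (by omega), map_zero, smul_zero, sub_zero])] at key
  replace key := congrArg (TensorProduct.map LinearMap.id (cRight F c)) key
  simp only [map_sum, map_smul, map_sub, map_cRight_comp12, map_cRight_Tfirst,
    map_cRight_compR] at key
  rw [Finset.sum_range_succ', Finset.sum_range_succ', Finset.sum_eq_zero] at key
  · rw [hzero ((0 : ℤ) + ((0 : ℕ) : ℤ)) (by simp), hzero ((0 : ℤ) + ((0 + 1 : ℕ) : ℤ)) (by simp)]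
      at key
    have h1 : (-2 : ℤ) + 1 = -1 := by norm_num
    simp [h1, hid, ← hD] at key
    rw [hD, LinearMap.comp_apply, ← key, ← hD]
    simp
  · intro i _
    rw [hzero (-2 + ((i + 1 + 1 : ℕ) : ℤ)) (by push_cast; omega),
      hzero (0 + ((i + 1 + 1 : ℕ) : ℤ)) (by positivity)]
    simp
end
end

section
/- (Right rationality and cocommutativity.) Let (V, Y, c) be a graded vertex coalgebra over F, v' ∈ (V^{⊗3})' and v ∈ V. Then: (a) the formal series ⟨v', (Id_V ⊗ Y(x_2))Y(x_1)v⟩ lies in F[x_1, x_2^{-1}][[x_1^{-1}, x_2]] and equals ι_{12} f(x_1,x_2) for a uniquely determined rational function f ∈ F[x_1,x_2]_S of the form f(x_1,x_2) = g(x_1,x_2)/(x_1^r x_2^s (x_1−x_2)^t) with g ∈ F[x_1,x_2] and r,s,t ∈ ℕ; and (b) ι_{12}^{-1}⟨v', (Id_V ⊗ Y(x_2))Y(x_1)v⟩ = ι_{21}^{-1}⟨v', (T ⊗ Id_V)(Id_V ⊗ Y(x_1))Y(x_2)v⟩ as rational functions. -/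
/- Common background for the formalization of "Vertex coalgebras, comodules,
cocommutativity and coassociativity" (K. Hubbard).

A vertex coalgebra `(V, Y, c)` is encoded by the family of coefficient maps
`Δ k : V →ₗ V ⊗ V` of the coproduct `Y(x)v = ∑ₖ Δ k v · x^(-k-1)` together with
the covacuum `c : V →ₗ F`.  All identities of formal series are encoded
coefficient-wise; in particular the Jacobi identity is encoded by its
(dual Borcherds) coefficient form. -/

noncomputable section

open scoped TensorProduct

variable (F : Type) [Field F] [CharZero F]

variable {V M : Type} [AddCommGroup V] [Module F V] [AddCommGroup M] [Module F M]

set_option linter.unusedSectionVars false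

variable {F}

theorem grT2_le {gr : ℤ → Submodule F V} {m : ℤ} {S : Submodule F (V ⊗[F] V)}
    (h : ∀ p q : ℤ, p + q = m → ∀ x ∈ gr p, ∀ y ∈ gr q, x ⊗ₜ[F] y ∈ S) :
    grT2 F gr m ≤ S := by
  refine iSup_le fun p => ?_
  rintro _ ⟨u, rfl⟩
  induction u with
  | zero => simp
  | add a b ha hb => rw [map_add]; exact S.add_mem ha hb
  | tmul x y => exact h p (m - p) (by ring) x x.2 y y.2

theorem grT3_le {gr : ℤ → Submodule F V} {m : ℤ} {S : Submodule F (V ⊗[F] (V ⊗[F] V))}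
    (h : ∀ p q l : ℤ, p + q + l = m → ∀ x ∈ gr p, ∀ y ∈ gr q, ∀ z ∈ gr l,
      x ⊗ₜ[F] (y ⊗ₜ[F] z) ∈ S) :
    grT3 F gr m ≤ S := by
  refine iSup_le fun p => ?_
  rintro _ ⟨u, rfl⟩
  induction u with
  | zero => simp
  | add a b ha hb => rw [map_add]; exact S.add_mem ha hb
  | tmul x w =>
    induction w with
    | zero => simp
    | add a b ha hb => rw [TensorProduct.tmul_add, map_add]; exact S.add_mem ha hb
    | tmul y z => exact h p.1 p.2 (m - p.1 - p.2) (by ring) x x.2 y y.2 z z.2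

theorem tmul_mem_grT3 {gr : ℤ → Submodule F V} {p q l m : ℤ} (hm : p + q + l = m) {x y z : V}
    (hx : x ∈ gr p) (hy : y ∈ gr q) (hz : z ∈ gr l) :
    x ⊗ₜ[F] (y ⊗ₜ[F] z) ∈ grT3 F gr m := by
  obtain rfl : l = m - p - q := by omega
  exact Submodule.mem_iSup_of_mem (p, q) ⟨⟨x, hx⟩ ⊗ₜ (⟨y, hy⟩ ⊗ₜ ⟨z, hz⟩), rfl⟩

theorem Tfirst_mem_grT3 {gr : ℤ → Submodule F V} {m : ℤ} {u : V ⊗[F] (V ⊗[F] V)}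
    (hu : u ∈ grT3 F gr m) : Tfirst F u ∈ grT3 F gr m := by
  suffices h : grT3 F gr m ≤ (grT3 F gr m).comap (Tfirst F) from h hu
  refine grT3_le fun p q l hm x hx y hy z hz => ?_
  exact tmul_mem_grT3 (by omega) hy hx hz

section Graded

variable {Δ : ℤ → V →ₗ[F] V ⊗[F] V} {gr : ℤ → Submodule F V}

theorem comp12_mem_grT3 (hΔ : ∀ r k : ℤ, ∀ v ∈ gr r, Δ k v ∈ grT2 F gr (r + k + 1))
    {r : ℤ} {v : V} (hv : v ∈ gr r) (m n : ℤ) :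
    comp12 F Δ m n v ∈ grT3 F gr (r + (m + n) + 2) := by
  suffices h : grT2 F gr (r + m + 1) ≤
      (grT3 F gr (r + (m + n) + 2)).comap (TensorProduct.map LinearMap.id (Δ n)) from
    h (hΔ r m v hv)
  refine grT2_le fun p q hpq x hx y hy => ?_
  suffices h : grT2 F gr (q + n + 1) ≤
      (grT3 F gr (r + (m + n) + 2)).comap (TensorProduct.mk F V (V ⊗[F] V) x) from
    h (hΔ q n y hy)
  exact grT2_le fun a b hab y₁ h₁ y₂ h₂ => tmul_mem_grT3 (by omega) hx h₁ h₂

theorem compR_mem_grT3 (hΔ : ∀ r k : ℤ, ∀ v ∈ gr r, Δ k v ∈ grT2 F gr (r + k + 1))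
    {r : ℤ} {v : V} (hv : v ∈ gr r) (m n : ℤ) :
    compR F Δ Δ m n v ∈ grT3 F gr (r + (m + n) + 2) := by
  suffices h : grT2 F gr (r + n + 1) ≤
      (grT3 F gr (r + (m + n) + 2)).comap ((TensorProduct.assoc F V V V).toLinearMap ∘ₗ
        TensorProduct.map (Δ m) LinearMap.id) from
    h (hΔ r n v hv)
  refine grT2_le fun p q hpq x hx y hy => ?_
  suffices h : grT2 F gr (p + m + 1) ≤
      (grT3 F gr (r + (m + n) + 2)).comap ((TensorProduct.assoc F V V V).toLinearMap ∘ₗ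
        (TensorProduct.mk F (V ⊗[F] V) V).flip y) from
    h (hΔ p m x hx)
  exact grT2_le fun a b hab x₁ h₁ x₂ h₂ => tmul_mem_grT3 (by omega) h₁ h₂ hy

/-- A functional in the graded dual of `V ⊗ V ⊗ V`, paired with a family of maps raising weight
by `m + n + 2`, sees only a bounded range of `m + n`. -/
theorem GradedDual3.exists_bound (hgr : iSup gr = ⊤) {f : V ⊗[F] (V ⊗[F] V) →ₗ[F] F}
    (hf : GradedDual3 F gr f) (P : ℤ → ℤ → V →ₗ[F] V ⊗[F] (V ⊗[F] V))
    (hP : ∀ r : ℤ, ∀ v ∈ gr r, ∀ m n : ℤ, P m n v ∈ grT3 F gr (r + (m + n) + 2)) (v : V) :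
    ∃ K : ℤ, ∀ m n : ℤ, K < m + n ∨ m + n < -K → f (P m n v) = 0 := by
  obtain ⟨s, hs⟩ := hf
  have hv : v ∈ iSup gr := hgr ▸ Submodule.mem_top
  induction hv using Submodule.iSup_induction' with
  | mem r x hx =>
    obtain ⟨K, hK⟩ := (s.image fun k => |k - r - 2|).bddAbove
    refine ⟨K, fun m n hmn => hs _ (fun hmem => ?_) _ (hP r x hx m n)⟩
    have := hK (Finset.mem_coe.2 (Finset.mem_image_of_mem (fun k => |k - r - 2|) hmem))
    rw [show r + (m + n) + 2 - r - 2 = m + n by ring, abs_le] at this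
    omega
  | zero => exact ⟨0, by simp⟩
  | add x y _ _ hx hy =>
    obtain ⟨K, hK⟩ := hx
    obtain ⟨L, hL⟩ := hy
    refine ⟨max K L, fun m n hmn => ?_⟩
    rw [map_add, map_add, hK m n (by omega), hL m n (by omega), add_zero]

end Graded

theorem gchoose_natCast (t i : ℕ) : gchoose F (t : ℤ) i = (t.choose i : F) := by
  rw [gchoose, div_eq_iff (Nat.cast_ne_zero.2 i.factorial_ne_zero), ← Nat.cast_mul, mul_comm,
    ← Nat.descFactorial_eq_factorial_mul_choose, ← descPochhammer_eval_eq_descFactorial,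
    descPochhammer_eval_eq_prod_range, Int.cast_natCast]

/-- The Jacobi identity at `a = t ≥ 0`, paired with a functional that kills the
`(Y(x₀) ⊗ Id)Y(x₂)` side, is weak cocommutativity with exponent `t`. -/
theorem JacobiId.weak_cocommutativity {Δ : ℤ → V →ₗ[F] V ⊗[F] V} (hJ : JacobiId F Δ Δ)
    (f : V ⊗[F] (V ⊗[F] V) →ₗ[F] F) (v : V) (htr : ∃ N : ℤ, ∀ k < N, Δ k v = 0) (t : ℕ)
    (hR : ∀ (i : ℕ) (n : ℤ), f (compR F Δ Δ (t + i) n v) = 0) (b c : ℤ) :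
    ∑ j ∈ Finset.range (t + 1), (t.choose j : F) * (-1) ^ j * f (comp12 F Δ (b + t - j) (c + j) v) =
      ∑ j ∈ Finset.range (t + 1), (t.choose j : F) * (-1) ^ j *
        f (Tfirst F (comp12 F Δ (c + j) (b + t - j) v)) := by
  obtain ⟨N, hN⟩ := htr
  have h := congrArg f (hJ t b c v)
  rw [finsum_eq_sum_of_support_subset (s := Finset.range (t + 1)),
    finsum_eq_sum_of_support_subset (s := Finset.range ((b + c - N).toNat + 1)),
    map_sum, map_sum] at h
  · simp only [map_smul, map_sub, gchoose_natCast, hR, smul_eq_mul, mul_zero,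
      Finset.sum_const_zero, mul_sub, Finset.sum_sub_distrib, zpow_natCast] at h
    rw [sub_eq_zero] at h
    convert h using 1
    · refine Finset.sum_congr rfl fun j _ => ?_
      rw [mul_comm (t.choose j : F), add_comm b]
    · rw [← Finset.sum_range_reflect]
      refine Finset.sum_congr rfl fun j hj => ?_
      have hjt : j ≤ t := Nat.lt_succ_iff.1 (Finset.mem_range.1 hj)
      rw [show t + 1 - 1 - j = t - j by omega, Nat.choose_symm hjt,
        show c + ((t - j : ℕ) : ℤ) = t + c - j by omega,
        show b + t - ((t - j : ℕ) : ℤ) = b + j by omega,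
        show (-1 : F) ^ t = (-1) ^ j * (-1) ^ (t - j) by rw [← pow_add, Nat.add_sub_cancel' hjt]]
      have hsq : (-1 : F) ^ j * (-1) ^ j = 1 := by rw [← mul_pow, neg_one_mul, neg_neg, one_pow]
      linear_combination (-(t.choose j : F) * (-1) ^ (t - j) *
        f (Tfirst F (comp12 F Δ (t + c - j) (b + j) v))) * hsq
  · intro i hi
    simp only [Finset.coe_range, Set.mem_Iio]
    by_contra hlt
    refine hi ?_
    simp only [compR, LinearMap.comp_apply, hN (b + c - i) (by omega), map_zero, smul_zero]
  · intro i hi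
    simp only [Finset.coe_range, Set.mem_Iio]
    by_contra hlt
    refine hi ?_
    simp only [gchoose_natCast, Nat.choose_eq_zero_of_lt (show t < i by omega), Nat.cast_zero,
      mul_zero, zero_smul]

theorem mulPoly_comm (r s t r' s' t' : ℕ) (ε : F) (A : ℤ → ℤ → F) :
    mulPoly F r s t ε (mulPoly F r' s' t' ε A) = mulPoly F r' s' t' ε (mulPoly F r s t ε A) := by
  funext m n
  simp only [mulPoly, Finset.mul_sum]
  rw [Finset.sum_comm]
  refine Finset.sum_congr rfl fun i _ => Finset.sum_congr rfl fun j _ => ?_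
  rw [show m - r - ((t - j : ℕ) : ℤ) - r' - ((t' - i : ℕ) : ℤ) =
      m - r' - ((t' - i : ℕ) : ℤ) - r - ((t - j : ℕ) : ℤ) by ring,
    show n - s - (j : ℤ) - s' - (i : ℤ) = n - s' - (i : ℤ) - s - (j : ℤ) by ring]
  ring

theorem mulPoly_eq_zero {A : ℤ → ℤ → F} {p : ℤ → ℤ → Prop} (r s t : ℕ) (ε : F) {m n : ℤ}
    (hA : ∀ m n, p m n → A m n = 0) (h : ∀ j ≤ t, p (m - r - (t - j : ℕ)) (n - s - j)) :
    mulPoly F r s t ε A m n = 0 :=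
  Finset.sum_eq_zero fun j hj => by
    rw [hA _ _ (h j (Nat.lt_succ_iff.1 (Finset.mem_range.1 hj))), mul_zero]

variable (F)

/-- Right rationality and cocommutativity: For a graded vertex
coalgebra `(V, Y, c)`, `v' ∈ (V^{⊗3})'` and `v ∈ V`:
(a) the series `⟨v', (Id ⊗ Y(x₂))Y(x₁)v⟩` lies in `F[x₁,x₂⁻¹][[x₁⁻¹,x₂]]` and
equals `ι₁₂ f` for a uniquely determined rational function
`f = g/(x₁^r x₂^s (x₁-x₂)^t)` with `g` a polynomial and `r,s,t ∈ ℕ`; and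
(b) `ι₁₂⁻¹⟨v', (Id ⊗ Y(x₂))Y(x₁)v⟩ = ι₂₁⁻¹⟨v', (T ⊗ Id)(Id ⊗ Y(x₁))Y(x₂)v⟩`.
Here `ι₁₂ f = A` is rendered coefficient-wise as
`x₁^r x₂^s (x₁-x₂)^t · A = g`, and similarly for `ι₂₁`. -/
theorem right_rationality_and_cocommutativity
    (Δ : ℤ → V →ₗ[F] V ⊗[F] V) (c : V →ₗ[F] F) (gr : ℤ → Submodule F V)
    (hVC : IsVertexCoalg F Δ c) (hgr : IsGradedVC F Δ gr)
    (f : V ⊗[F] (V ⊗[F] V) →ₗ[F] F) (hf : GradedDual3 F gr f) (v : V)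
    -- `A m n` : coefficient of `x₁^m x₂^n` in `⟨v', (Id ⊗ Y(x₂))Y(x₁)v⟩`
    (A : ℤ → ℤ → F) (hA : A = fun m n => f (comp12 F Δ (-m - 1) (-n - 1) v))
    -- `B m n` : coefficient of `x₁^m x₂^n` in `⟨v', (T ⊗ Id)(Id ⊗ Y(x₁))Y(x₂)v⟩`
    (B : ℤ → ℤ → F) (hB : B = fun m n => f (Tfirst F (comp12 F Δ (-n - 1) (-m - 1) v))) :
    (∃ N : ℤ, ∀ m n : ℤ, (N < m → A m n = 0) ∧ (n < -N → A m n = 0)) ∧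
    ∃ (g : ℤ → ℤ → F) (r s t : ℕ), IsPolyCoeff F g ∧
      (∀ m n : ℤ, mulPoly F r s t (-1) A m n = g m n) ∧
      (∀ m n : ℤ, mulPoly F r s t (-1) B m n = g m n) ∧
      (∀ (g' : ℤ → ℤ → F) (r' s' t' : ℕ), IsPolyCoeff F g' →
        (∀ m n : ℤ, mulPoly F r' s' t' (-1) A m n = g' m n) →
        ∀ m n : ℤ, mulPoly F r' s' t' (-1) g m n = mulPoly F r s t (-1) g' m n) := by
  obtain ⟨⟨-, -, -, -, htr⟩, hJ⟩ := hVC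
  obtain ⟨hint, -, hΔ⟩ := hgr
  have htop := hint.submodule_iSup_eq_top
  obtain ⟨N, hN⟩ := htr v
  obtain ⟨K₁, hK₁⟩ := hf.exists_bound htop (comp12 F Δ)
    (fun r x hx => comp12_mem_grT3 hΔ hx) v
  obtain ⟨K₂, hK₂⟩ := hf.exists_bound htop (fun m n => Tfirst F ∘ₗ comp12 F Δ m n)
    (fun r x hx m n => Tfirst_mem_grT3 (comp12_mem_grT3 hΔ hx m n)) v
  obtain ⟨K₃, hK₃⟩ := hf.exists_bound htop (compR F Δ Δ) (fun r x hx => compR_mem_grT3 hΔ hx) v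
  have hA₀ : ∀ m n, -N - 1 < m ∨ K₁ < -m - 1 + (-n - 1) ∨ -m - 1 + (-n - 1) < -K₁ → A m n = 0 := by
    rintro m n (h | h)
    · simp only [hA, comp12, LinearMap.comp_apply, hN (-m - 1) (by omega), map_zero]
    · rw [hA]; exact hK₁ _ _ h
  have hB₀ : ∀ m n, -N - 1 < n ∨ K₂ < -n - 1 + (-m - 1) ∨ -n - 1 + (-m - 1) < -K₂ → B m n = 0 := by
    rintro m n (h | h)
    · simp only [hB, comp12, LinearMap.comp_apply, hN (-n - 1) (by omega), map_zero]
    · rw [hB]; exact hK₂ _ _ h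
  obtain ⟨t, ht⟩ : ∃ t : ℕ, K₃ - N < t := ⟨(K₃ - N).toNat + 1, by omega⟩
  have hR : ∀ (i : ℕ) (n : ℤ), f (compR F Δ Δ (t + i) n v) = 0 := by
    intro i n
    by_cases hn : n < N
    · simp only [compR, LinearMap.comp_apply, hN n hn, map_zero]
    · exact hK₃ _ _ (by omega)
  have hcocom : ∀ r s : ℕ, mulPoly F r s t (-1) A = mulPoly F r s t (-1) B := by
    intro r s
    funext m n
    have h := hJ.weak_cocommutativity f v ⟨N, hN⟩ t hR (r - m - 1) (s - n - 1)
    simp only [mulPoly, hA, hB]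
    have key : ∀ j ∈ Finset.range (t + 1),
        -(m - r - ((t - j : ℕ) : ℤ)) - 1 = r - m - 1 + t - j ∧
          -(n - s - (j : ℤ)) - 1 = s - n - 1 + j := fun j hj => by
      rw [Finset.mem_range] at hj
      omega
    refine (Finset.sum_congr rfl fun j hj => ?_).trans
      (h.trans (Finset.sum_congr rfl fun j hj => ?_)) <;> rw [(key j hj).1, (key j hj).2]
  refine ⟨⟨max (-N - 1) (K₁ - N + 1), fun m n => ⟨fun h => hA₀ m n (by omega), fun h =>
    hA₀ m n (by omega)⟩⟩, ?_⟩
  obtain ⟨R, hR'⟩ : ∃ R : ℕ, -N ≤ R ∧ K₁ - N + 1 ≤ R ∧ K₂ - N + 1 ≤ R ∧ t ≤ R :=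
    ⟨(-N).toNat + (K₁ - N + 1).toNat + (K₂ - N + 1).toNat + t, by omega⟩
  have hAz : ∀ m n : ℤ, n < 0 ∨ 3 * R < m → mulPoly F R R t (-1) A m n = 0 := fun m n h =>
    mulPoly_eq_zero R R t (-1) hA₀ fun j hj => by omega
  have hBz : ∀ m n : ℤ, m < 0 ∨ 3 * R < n → mulPoly F R R t (-1) A m n = 0 := fun m n h => by
    rw [hcocom]
    exact mulPoly_eq_zero R R t (-1) hB₀ fun j hj => by omega
  refine ⟨mulPoly F R R t (-1) A, R, R, t, ⟨?_, ?_⟩, fun _ _ => rfl, fun m n => by rw [hcocom],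
    fun g' r' s' t' _ hg' m n => ?_⟩
  · refine ((Set.finite_Icc (0 : ℤ) (3 * R)).prod (Set.finite_Icc (0 : ℤ) (3 * R))).subset ?_
    rintro ⟨m, n⟩ hmn
    by_contra hout
    simp only [Set.mem_prod, Set.mem_Icc] at hout
    by_cases h : n < 0 ∨ 3 * R < m
    · exact hmn (hAz m n h)
    · exact hmn (hBz m n (by omega))
  · rintro m n (h | h)
    · exact hBz m n (Or.inl h)
    · exact hAz m n (Or.inl h)
  · rw [mulPoly_comm, funext₂ hg']
end
end
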